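/- Let T : Fin d → Fin d → Matrix (Fin D) (Fin D) ℂ define a matrix product operator ρ_N on (ℂ^d)^{⊗N} by ρ_N = Σ_{i⃗, j⃗ ∈ (Fin d)^N} Tr(T^{i_1 j_1} ⋯ T^{i_N j_N}) |i⃗⟩⟨j⃗|. Suppose the vectorized tensor T̂ : Fin d × Fin d → Matrix (Fin D) (Fin D) ℂ, T̂^{(i,j)} := T^{i j}, viewed as an MPS tensor with physical dimension d², is injective with injectivity length L and admits positive definite transfer fixed points. Let G be a 2-site operator on ℂ^d ⊗ ℂ^d, and N > 2L + 3. Then the strong symmetry generator condition Σ_{n=1}^N G_n ρ_N = 0 (periodic boundary) holds if and only if there exists a family B : Fin d → Fin d → Matrix (Fin D) (Fin D) ℂ such that for all i_1, i_2, j_1, j_2 ∈ Fin d: Σ_{k_1, k_2 ∈ Fin d} G^{i_1 i_2}_{k_1 k_2} T^{k_1 j_1} T^{k_2 j_2} = T^{i_1 j_1} B^{i_2 j_2} − B^{i_1 j_1} T^{i_2 j_2} (matrix products). -/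

import Mathlib

open Matrix
open scoped ComplexOrder

/-- Cyclic shift of a site index: `cyc a t` is `a + t (mod N)`. -/
def cyc {N : ℕ} (a : Fin N) (t : ℕ) : Fin N :=
  ⟨(a.val + t) % N, Nat.mod_lt _ (Nat.lt_of_le_of_lt (Nat.zero_le _) a.isLt)⟩

/-- Ordered product `A^{i_1} ⋯ A^{i_m}`. -/
noncomputable def prodA {d D m : ℕ} (A : Fin d → Matrix (Fin D) (Fin D) ℂ)
    (i : Fin m → Fin d) : Matrix (Fin D) (Fin D) ℂ :=
  (List.ofFn fun t => A (i t)).prod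

/-- Matrix product state on `N` cyclic sites:
`ψ_N(i_1,…,i_N) = Tr(A^{i_1} ⋯ A^{i_N})`. -/
noncomputable def mps {d D : ℕ} (A : Fin d → Matrix (Fin D) (Fin D) ℂ) (N : ℕ) :
    (Fin N → Fin d) → ℂ :=
  fun i => (prodA A i).trace

/-- A `k`-site operator `o` acting on sites `n, n+1, …, n+k-1 (mod N)` of a
periodic chain of `N` sites, as a matrix on the full configuration space. -/
noncomputable def localOp {d k N : ℕ}
    (o : Matrix (Fin k → Fin d) (Fin k → Fin d) ℂ) (n : Fin N) :
    Matrix (Fin N → Fin d) (Fin N → Fin d) ℂ :=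
  Matrix.of fun x y =>
    o (fun t => x (cyc n t.val)) (fun t => y (cyc n t.val)) *
      (if ∀ m : Fin N, (∀ t : Fin k, m ≠ cyc n t.val) → x m = y m then 1 else 0)

/-- `O_N = Σ_{n=1}^N o_n`, the sum of all translates of a `k`-site operator. -/
noncomputable def opSum {d k N : ℕ}
    (o : Matrix (Fin k → Fin d) (Fin k → Fin d) ℂ) :
    Matrix (Fin N → Fin d) (Fin N → Fin d) ℂ :=
  ∑ n : Fin N, localOp o n

/-- `A` is injective with injectivity length `L`: the map
`Γ_L : X ↦ (Tr(X A^{i_1} ⋯ A^{i_L}))_{i}` is injective. -/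
noncomputable def InjectiveLen {d D : ℕ} (A : Fin d → Matrix (Fin D) (Fin D) ℂ)
    (L : ℕ) : Prop :=
  Function.Injective fun X : Matrix (Fin D) (Fin D) ℂ =>
    fun i : Fin L → Fin d => (X * prodA A i).trace

/-- `ρL, ρR` are positive definite fixed points of the transfer operator of `A`. -/
def TransferFixedPoints {d D : ℕ} (A : Fin d → Matrix (Fin D) (Fin D) ℂ)
    (ρL ρR : Matrix (Fin D) (Fin D) ℂ) : Prop :=
  ρL.PosDef ∧ ρR.PosDef ∧
    (∑ i, (A i)ᴴ * ρL * A i) = ρL ∧ (∑ i, A i * ρR * (A i)ᴴ) = ρR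

/-- `B` satisfies the local telescoping equation for `(A, o, ε)`, where `o` is a
`(k+1)`-site operator and `B` is a family of matrices indexed by `k`-tuples:
`Σ_j o^{i}_{j} A^{j_0}⋯A^{j_k} − ε A^{i_0}⋯A^{i_k}
  = A^{i_0} B^{i_1…i_k} − B^{i_0…i_{k-1}} A^{i_k}`. -/
noncomputable def Telescopes {d D k : ℕ} (A : Fin d → Matrix (Fin D) (Fin D) ℂ)
    (o : Matrix (Fin (k+1) → Fin d) (Fin (k+1) → Fin d) ℂ) (ε : ℂ)
    (B : (Fin k → Fin d) → Matrix (Fin D) (Fin D) ℂ) : Prop :=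
  ∀ i : Fin (k+1) → Fin d,
    (∑ j : Fin (k+1) → Fin d, o i j • prodA A j) - ε • prodA A i
      = A (i 0) * B (fun t => i t.succ) - B (fun t => i t.castSucc) * A (i (Fin.last k))

/-- Matrix product (density) operator on `N` cyclic sites:
`ρ_N = Σ_{i,j} Tr(T^{i_1 j_1} ⋯ T^{i_N j_N}) |i⟩⟨j|`. -/
noncomputable def mpo {d D N : ℕ}
    (T : Fin d → Fin d → Matrix (Fin D) (Fin D) ℂ) :
    Matrix (Fin N → Fin d) (Fin N → Fin d) ℂ :=
  Matrix.of fun i j => ((List.ofFn fun n => T (i n) (j n)).prod).trace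

/-- Injectivity with injectivity length `L` for an MPS tensor over an arbitrary
physical index type `ι`. -/
noncomputable def InjectiveLen' {ι : Type*} {D : ℕ}
    (A : ι → Matrix (Fin D) (Fin D) ℂ) (L : ℕ) : Prop :=
  Function.Injective fun X : Matrix (Fin D) (Fin D) ℂ =>
    fun i : Fin L → ι => (X * (List.ofFn fun t => A (i t)).prod).trace

/-- Positive definite transfer fixed points for an MPS tensor over an arbitrary
finite physical index type. -/
def TransferFixedPoints' {ι : Type*} [Fintype ι] {D : ℕ}
    (A : ι → Matrix (Fin D) (Fin D) ℂ)
    (ρL ρR : Matrix (Fin D) (Fin D) ℂ) : Prop :=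
  ρL.PosDef ∧ ρR.PosDef ∧
    (∑ i, (A i)ᴴ * ρL * A i) = ρL ∧ (∑ i, A i * ρR * (A i)ᴴ) = ρR

/-- The ordered product of the matrices `A p` along a word. -/
def wordProd {P K n : Type*} [Field K] [Fintype n] [DecidableEq n] (A : P → Matrix n n K)
    (w : List P) : Matrix n n K :=
  (w.map A).prod

/-- The sum over all bonds of an open word of the word product with the matrix `F a b` put in place
of the letters `a`, `b` adjacent to the bond. -/
def bondSum {P K n : Type*} [Field K] [Fintype n] [DecidableEq n] (A : P → Matrix n n K)
    (F : P → P → Matrix n n K) : List P → Matrix n n K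
  | [] => 0
  | [_] => 0
  | a :: b :: t => F a b * wordProd A t + A a * bondSum A F (b :: t)

/-- The trace of a word product with `F a b` in place of the first two letters `a`, `b`. -/
def headTerm {P K n : Type*} [Field K] [Fintype n] [DecidableEq n] (A : P → Matrix n n K)
    (F : P → P → Matrix n n K) : List P → K
  | a :: b :: t => (F a b * wordProd A t).trace
  | _ => 0

/-- The sum over all bonds of a periodic word of the traced word product with `F` inserted. -/
def ringSum {P K n : Type*} [Field K] [Fintype n] [DecidableEq n] (A : P → Matrix n n K)
    (F : P → P → Matrix n n K) (l : List P) : K :=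
  ∑ k ∈ Finset.range l.length, headTerm A F (l.rotate k)

/-- A matrix is determined by the traces of its products with the word products of length `m`. -/
def TraceSeparating {P K n : Type*} [Field K] [Fintype n] [DecidableEq n] (A : P → Matrix n n K)
    (m : ℕ) : Prop :=
  ∀ X : Matrix n n K, (∀ w : List P, w.length = m → (X * wordProd A w).trace = 0) → X = 0

/-- On words of length `m` with fixed end letters, `bondSum` factors linearly through the product of
the inner word. -/
def BondFactor {P K n : Type*} [Field K] [Fintype n] [DecidableEq n] (A : P → Matrix n n K)
    (F : P → P → Matrix n n K) (m : ℕ) (Λ : P → P → Matrix n n K →ₗ[K] Matrix n n K) : Prop :=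
  ∀ q p w, w.length = m → bondSum A F (q :: (w ++ [p])) = Λ q p (wordProd A w)

section Words

variable {P K n : Type*} [Field K] [Fintype n] [DecidableEq n]
  {A : P → Matrix n n K} {F : P → P → Matrix n n K}

@[simp] theorem wordProd_nil : wordProd A [] = 1 := rfl

@[simp] theorem wordProd_cons (a : P) (w : List P) :
    wordProd A (a :: w) = A a * wordProd A w := by
  simp [wordProd]

@[simp] theorem wordProd_append (u v : List P) :
    wordProd A (u ++ v) = wordProd A u * wordProd A v := by
  simp [wordProd]

theorem trace_wordProd_rotate (l : List P) (k : ℕ) :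
    (wordProd A (l.rotate k)).trace = (wordProd A l).trace := by
  induction k with
  | zero => simp
  | succ k ih =>
    rw [← List.rotate_rotate, ← ih]
    rcases l.rotate k with _ | ⟨a, t⟩
    · simp
    · simp [Matrix.trace_mul_comm (A a)]

theorem bondSum_append_cons (u v : List P) (r : P) :
    bondSum A F (u ++ r :: v) =
      bondSum A F (u ++ [r]) * wordProd A v + wordProd A u * bondSum A F (r :: v) := by
  induction u with
  | nil => simp [bondSum]
  | cons a t ih =>
    rcases t with _ | ⟨b, t⟩
    · simp [bondSum]
    · simp only [List.cons_append, bondSum, wordProd_cons, wordProd_append, wordProd_nil] at ih ⊢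
      rw [ih]
      noncomm_ring

theorem sum_headTerm_rotate (a : P) (u v : List P) :
    ∑ k ∈ Finset.range u.length, headTerm A F ((a :: u ++ v).rotate k) =
      (bondSum A F (a :: u) * wordProd A v).trace := by
  induction u generalizing a v with
  | nil => simp [bondSum]
  | cons b t ih =>
    rw [List.length_cons, Finset.sum_range_succ']
    have h : ∀ k, (a :: b :: t ++ v).rotate (k + 1) = (b :: t ++ (v ++ [a])).rotate k := by
      intro k
      simp [List.rotate_cons_succ]
    rw [Finset.sum_congr rfl fun k _ => congrArg (headTerm A F) (h k), ih]
    simp only [bondSum, headTerm, List.rotate_zero, List.cons_append, wordProd_append,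
      wordProd_cons, wordProd_nil, mul_one, add_mul, Matrix.trace_add, mul_assoc]
    rw [Matrix.trace_mul_comm (A a), add_comm]
    simp only [mul_assoc]

/-- Cutting the ring at the letters `q` and `p` splits the sum over bonds into two open sums. -/
theorem ringSum_split (q p : P) (w v : List P) :
    ringSum A F (q :: w ++ p :: v) =
      (wordProd A v * bondSum A F (q :: (w ++ [p]))).trace +
        (bondSum A F (p :: (v ++ [q])) * wordProd A w).trace := by
  have h1 := sum_headTerm_rotate (A := A) (F := F) q (w ++ [p]) v
  have h2 := sum_headTerm_rotate (A := A) (F := F) p (v ++ [q]) w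
  rw [Matrix.trace_mul_comm (wordProd A v), ← h1, ← h2, ringSum]
  have hl : (q :: w ++ p :: v).length = (w ++ [p]).length + (v ++ [q]).length := by
    simp; omega
  rw [hl, Finset.sum_range_add]
  congr 1
  · refine Finset.sum_congr rfl fun k _ => ?_
    simp
  · refine Finset.sum_congr rfl fun k _ => ?_
    have : (w ++ [p]).length = (q :: w).length := by simp
    rw [this, ← List.rotate_rotate, List.rotate_append_length_eq]
    simp

/-- A telescoping `F`, up to a multiple of `A a * A b`, has only that multiple as its ring sum. -/
theorem ringSum_of_telescoping (B : P → Matrix n n K) (c : K)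
    (hF : ∀ a b, F a b = A a * B b - B a * A b + c • (A a * A b)) (l : List P)
    (hl : 2 ≤ l.length) :
    ringSum A F l = l.length * (c * (wordProd A l).trace) := by
  let g : List P → K := fun l => match l with
    | a :: t => (B a * wordProd A t).trace
    | [] => 0
  have hterm : ∀ m : List P, 2 ≤ m.length →
      headTerm A F m = g (m.rotate 1) - g m + c * (wordProd A m).trace := by
    rintro (_ | ⟨a, _ | ⟨b, t⟩⟩) hm
    · simp at hm
    · simp at hm
    · have h1 : (a :: b :: t).rotate 1 = b :: (t ++ [a]) := by simp
      simp only [h1, g, headTerm, hF, wordProd_cons, wordProd_append, wordProd_nil, mul_one,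
        add_mul, sub_mul, Matrix.trace_add, Matrix.trace_sub, mul_assoc, smul_mul_assoc,
        Matrix.trace_smul, smul_eq_mul]
      rw [Matrix.trace_mul_comm (A a) (B b * wordProd A t)]
      simp only [mul_assoc]
  rw [ringSum, Finset.sum_congr rfl fun k _ => hterm (l.rotate k) (by simpa using hl)]
  simp only [Finset.sum_add_distrib, trace_wordProd_rotate, List.rotate_rotate]
  rw [Finset.sum_range_sub (fun k => g (l.rotate k))]
  simp

end Words

section Injective

variable {P K n : Type*} [Field K] [Fintype n] [DecidableEq n]
  {A : P → Matrix n n K} {F : P → P → Matrix n n K} {al ar : P → Matrix n n K}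

theorem eq_of_forall_left_mul [Fintype P] (hal : ∑ q, al q * A q = 1) {X Y : Matrix n n K}
    (h : ∀ q, A q * X = A q * Y) : X = Y := by
  rw [← one_mul X, ← one_mul Y, ← hal, Finset.sum_mul, Finset.sum_mul]
  exact Finset.sum_congr rfl fun q _ => by rw [mul_assoc, h, mul_assoc]

theorem eq_of_forall_right_mul [Fintype P] (har : ∑ q, A q * ar q = 1) {X Y : Matrix n n K}
    (h : ∀ q, X * A q = Y * A q) : X = Y := by
  rw [← mul_one X, ← mul_one Y, ← har, Finset.mul_sum, Finset.mul_sum]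
  exact Finset.sum_congr rfl fun q _ => by rw [← mul_assoc, h, mul_assoc]

/-- A balanced family factors through a common middle matrix. -/
theorem exists_middle [Fintype P] (hal : ∑ q, al q * A q = 1) (har : ∑ q, A q * ar q = 1)
    {U V : P → Matrix n n K} (h : ∀ r s, U r * A s = A r * V s) :
    ∃ M, (∀ r, U r = A r * M) ∧ ∀ s, V s = M * A s := by
  have hU : ∀ r, U r = A r * ∑ s, V s * ar s := fun r => by
    rw [← mul_one (U r), ← har, Finset.mul_sum, Finset.mul_sum]
    exact Finset.sum_congr rfl fun s _ => by rw [← mul_assoc, h, mul_assoc]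
  refine ⟨_, hU, fun s => eq_of_forall_left_mul hal fun r => ?_⟩
  rw [← h, hU, mul_assoc]

theorem TraceSeparating.mono [Fintype P] (har : ∑ q, A q * ar q = 1) {L : ℕ}
    (hL : TraceSeparating A L) {m : ℕ} (hm : L ≤ m) : TraceSeparating A m := by
  induction m, hm using Nat.le_induction with
  | base => exact hL
  | succ m _ ih =>
    intro X hX
    refine eq_of_forall_right_mul har fun q => ?_
    rw [zero_mul]
    refine ih _ fun w hw => ?_
    rw [mul_assoc, ← wordProd_cons]
    exact hX _ (by simp [hw])

theorem span_wordProd_eq_top {m : ℕ}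
    (hm : TraceSeparating A m) :
    Submodule.span K (Set.range fun w : {w : List P // w.length = m} => wordProd A w.1) = ⊤ := by
  by_contra hne
  obtain ⟨f, hf, hle⟩ := Submodule.exists_le_ker_of_lt_top _ (lt_top_iff_ne_top.2 hne)
  let X : Matrix n n K := Matrix.of fun i j => f (Matrix.single j i 1)
  have hfX : ∀ Y, f Y = (X * Y).trace := by
    intro Y
    conv_lhs => rw [Matrix.matrix_eq_sum_single Y]
    simp only [map_sum, Matrix.trace, Matrix.diag_apply, Matrix.mul_apply]
    rw [Finset.sum_comm]
    refine Finset.sum_congr rfl fun i _ => Finset.sum_congr rfl fun j _ => ?_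
    have : Matrix.single j i (Y j i) = Y j i • Matrix.single j i (1 : K) := by
      simp [Matrix.smul_single]
    rw [this, map_smul, smul_eq_mul, mul_comm]
    rfl
  have hX0 : X = 0 := hm X fun w hw => by
    rw [← hfX]
    exact hle (Submodule.subset_span ⟨⟨w, hw⟩, rfl⟩)
  apply hf
  ext1 Y
  simp [hfX, hX0]

/-- Linear maps that agree on all word products of a given spanning length are equal. -/
theorem linearMap_ext_wordProd {V : Type*} [AddCommGroup V] [Module K V] {m : ℕ}
    (hm : TraceSeparating A m)
    {f g : Matrix n n K →ₗ[K] V}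
    (h : ∀ w : List P, w.length = m → f (wordProd A w) = g (wordProd A w)) : f = g :=
  LinearMap.ext_on (span_wordProd_eq_top hm) (by rintro _ ⟨w, rfl⟩; exact h w.1 w.2)

theorem exists_linearMap_of_span {ι V W : Type*} [AddCommGroup V] [Module K V] [AddCommGroup W]
    [Module K W] (a : ι → V) (s : ι → W) (ha : Submodule.span K (Set.range a) = ⊤)
    (h : ∀ c : ι →₀ K, Finsupp.linearCombination K a c = 0 → Finsupp.linearCombination K s c = 0) :
    ∃ f : V →ₗ[K] W, ∀ i, f (a i) = s i := by
  obtain ⟨g, hg⟩ := LinearMap.exists_rightInverse_of_surjective (Finsupp.linearCombination K a)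
    (by rw [Finsupp.range_linearCombination, ha])
  refine ⟨Finsupp.linearCombination K s ∘ₗ g, fun i => ?_⟩
  have h0 := h (g (a i) - Finsupp.single i 1) (by
    have := LinearMap.congr_fun hg (a i)
    simp only [LinearMap.comp_apply, LinearMap.id_apply] at this
    simp [this])
  rw [map_sub, sub_eq_zero] at h0
  simpa using h0

/-- If the ring sums of all words of length `m + k + 2` vanish, `bondSum` factors at length `m`. -/
theorem exists_bondFactor_of_ringSum {m k : ℕ}
    (hm : TraceSeparating A m)
    (hk : TraceSeparating A k)
    (h : ∀ l : List P, l.length = m + k + 2 → ringSum A F l = 0) :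
    ∃ Λ, BondFactor A F m Λ := by
  have key : ∀ q p, ∃ f : Matrix n n K →ₗ[K] Matrix n n K,
      ∀ w : {w : List P // w.length = m},
        f (wordProd A w.1) = bondSum A F (q :: (w.1 ++ [p])) := by
    intro q p
    refine exists_linearMap_of_span _ _ (span_wordProd_eq_top hm) fun c hc => hk _ fun v hv => ?_
    let φ : Matrix n n K →ₗ[K] K :=
      Matrix.traceLinearMap n K K ∘ₗ LinearMap.mulRight K (wordProd A v)
    let ψ : Matrix n n K →ₗ[K] K :=
      -(Matrix.traceLinearMap n K K ∘ₗ LinearMap.mulLeft K (bondSum A F (p :: (v ++ [q]))))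
    have hφψ : φ ∘ₗ Finsupp.linearCombination K
          (fun w : {w : List P // w.length = m} => bondSum A F (q :: (w.1 ++ [p]))) =
        ψ ∘ₗ Finsupp.linearCombination K
          (fun w : {w : List P // w.length = m} => wordProd A w.1) := by
      ext w
      have := h (q :: w.1 ++ p :: v) (by simp [w.2, hv]; omega)
      rw [ringSum_split, Matrix.trace_mul_comm (wordProd A v)] at this
      simpa [φ, ψ] using eq_neg_of_add_eq_zero_left this
    have := LinearMap.congr_fun hφψ c
    rw [LinearMap.comp_apply φ, LinearMap.comp_apply ψ, hc, map_zero] at this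
    simpa [φ] using this
  choose Λ hΛ using key
  exact ⟨Λ, fun q p w hw => (hΛ q p ⟨w, hw⟩).symm⟩

theorem BondFactor.mul_left {m : ℕ} {Λ Λ' : P → P → Matrix n n K →ₗ[K] Matrix n n K}
    (hm : TraceSeparating A m)
    (h : BondFactor A F m Λ) (h' : BondFactor A F (m + 1) Λ') (q r p : P) (X : Matrix n n K) :
    Λ' q p (A r * X) = A q * Λ r p X + F q r * X * A p := by
  have := linearMap_ext_wordProd hm (f := Λ' q p ∘ₗ LinearMap.mulLeft K (A r))
    (g := LinearMap.mulLeft K (A q) ∘ₗ Λ r p +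
      LinearMap.mulRight K (A p) ∘ₗ LinearMap.mulLeft K (F q r)) fun w hw => by
    simp only [LinearMap.comp_apply, LinearMap.add_apply, LinearMap.mulLeft_apply,
      LinearMap.mulRight_apply]
    rw [← wordProd_cons, ← h' q p (r :: w) (by simp [hw]), ← h r p w hw]
    simp [bondSum, mul_assoc, add_comm]
  simpa using LinearMap.congr_fun this X

theorem BondFactor.mul_mul {k m : ℕ} {Λ Λ' Λ'' : P → P → Matrix n n K →ₗ[K] Matrix n n K}
    (hk : TraceSeparating A k)
    (hm : TraceSeparating A m)
    (h : BondFactor A F k Λ) (h' : BondFactor A F m Λ') (h'' : BondFactor A F (k + m + 1) Λ'')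
    (q r p : P) (X Y : Matrix n n K) :
    Λ'' q p (X * A r * Y) = Λ q r X * Y * A p + A q * X * Λ' r p Y := by
  have hw : ∀ u : List P, u.length = k → ∀ v : List P, v.length = m →
      Λ'' q p (wordProd A u * A r * wordProd A v) =
        Λ q r (wordProd A u) * wordProd A v * A p +
          A q * wordProd A u * Λ' r p (wordProd A v) := by
    intro u hu v hv
    rw [← h q r u hu, ← h' r p v hv, mul_assoc, ← wordProd_cons, ← wordProd_append,
      ← h'' q p _ (by simp [hu, hv]; omega)]
    have := bondSum_append_cons (A := A) (F := F) (q :: u) (v ++ [p]) r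
    simpa [mul_assoc] using this
  have hX : ∀ v : List P, v.length = m → ∀ X,
      Λ'' q p (X * A r * wordProd A v) =
        Λ q r X * wordProd A v * A p + A q * X * Λ' r p (wordProd A v) := by
    intro v hv X
    have := linearMap_ext_wordProd hk
      (f := Λ'' q p ∘ₗ LinearMap.mulRight K (wordProd A v) ∘ₗ LinearMap.mulRight K (A r))
      (g := LinearMap.mulRight K (A p) ∘ₗ LinearMap.mulRight K (wordProd A v) ∘ₗ Λ q r +
        LinearMap.mulRight K (Λ' r p (wordProd A v)) ∘ₗ LinearMap.mulLeft K (A q))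
      fun u hu => by simpa using hw u hu v hv
    simpa using LinearMap.congr_fun this X
  have := linearMap_ext_wordProd hm
    (f := Λ'' q p ∘ₗ LinearMap.mulLeft K (X * A r))
    (g := LinearMap.mulRight K (A p) ∘ₗ LinearMap.mulLeft K (Λ q r X) +
      LinearMap.mulLeft K (A q * X) ∘ₗ Λ' r p)
    fun v hv => by simpa [mul_assoc] using hX v hv X
  simpa [mul_assoc] using LinearMap.congr_fun this Y

theorem BondFactor.mul_right {m : ℕ} {Λ Λ' : P → P → Matrix n n K →ₗ[K] Matrix n n K}
    (hm : TraceSeparating A m)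
    (h : BondFactor A F m Λ) (h' : BondFactor A F (m + 1) Λ') (q r p : P) (X : Matrix n n K) :
    Λ' q p (X * A r) = Λ q r X * A p + A q * X * F r p := by
  have := linearMap_ext_wordProd hm (f := Λ' q p ∘ₗ LinearMap.mulRight K (A r))
    (g := LinearMap.mulRight K (A p) ∘ₗ Λ q r +
      LinearMap.mulRight K (F r p) ∘ₗ LinearMap.mulLeft K (A q)) fun w hw => by
    have hb := bondSum_append_cons (A := A) (F := F) (q :: w) [p] r
    have hr : wordProd A w * A r = wordProd A (w ++ [r]) := by simp
    simp only [LinearMap.comp_apply, LinearMap.add_apply, LinearMap.mulLeft_apply,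
      LinearMap.mulRight_apply]
    rw [hr, ← h' q p (w ++ [r]) (by simp [hw]), ← h q r w hw]
    simpa [bondSum] using hb
  simpa using LinearMap.congr_fun this X

/-- Factorizations at two consecutive lengths produce one at the next length. -/
theorem BondFactor.exists_succ [Fintype P] (har : ∑ q, A q * ar q = 1) {m : ℕ}
    {Λ Λ' : P → P → Matrix n n K →ₗ[K] Matrix n n K} (hm : TraceSeparating A m)
    (h : BondFactor A F m Λ) (h' : BondFactor A F (m + 1) Λ') :
    ∃ Λ'', BondFactor A F (m + 2) Λ'' := by
  refine ⟨fun q p => ∑ s, (LinearMap.mulLeft K (A q) ∘ₗ Λ' s p ∘ₗ LinearMap.mulLeft K (ar s) +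
    LinearMap.mulRight K (A p) ∘ₗ LinearMap.mulLeft K (F q s) ∘ₗ LinearMap.mulLeft K (ar s)),
    fun q p w hw => ?_⟩
  obtain ⟨u, r, rfl⟩ : ∃ u r, w = u ++ [r] := by
    rcases List.eq_nil_or_concat w with rfl | ⟨u, r, hu⟩
    · simp at hw
    · exact ⟨u, r, by simpa using hu⟩
  have hu : u.length = m + 1 := by simpa using hw
  have hb := bondSum_append_cons (A := A) (F := F) (q :: u) [p] r
  simp only [bondSum, List.cons_append, wordProd_cons, wordProd_nil, mul_one, mul_zero,
    add_zero] at hb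
  simp only [List.append_assoc, List.cons_append, List.nil_append, wordProd_append, wordProd_cons,
    wordProd_nil, mul_one]
  rw [hb, h' q r u hu]
  have hY : wordProd A u = ∑ s, A s * (ar s * wordProd A u) := by
    simp_rw [← mul_assoc, ← Finset.sum_mul, har, one_mul]
  generalize wordProd A u = Y at hY ⊢
  conv_lhs => rw [hY]
  simp only [LinearMap.sum_apply, LinearMap.add_apply, LinearMap.comp_apply,
    LinearMap.mulLeft_apply, LinearMap.mulRight_apply, map_sum, Finset.mul_sum, Finset.sum_mul]
  rw [← Finset.sum_add_distrib]
  refine Finset.sum_congr rfl fun s _ => ?_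
  rw [h.mul_left hm h' q s r, ← mul_assoc (ar s) Y, h.mul_right hm h' s r p]
  noncomm_ring

theorem exists_bondFactor [Fintype P] (har : ∑ q, A q * ar q = 1) {L : ℕ}
    (hL : TraceSeparating A L) (h0 : ∃ Λ, BondFactor A F L Λ)
    (h1 : ∃ Λ, BondFactor A F (L + 1) Λ) (i : ℕ) : ∃ Λ, BondFactor A F (L + i) Λ := by
  have : (∃ Λ, BondFactor A F (L + i) Λ) ∧ ∃ Λ, BondFactor A F (L + i + 1) Λ := by
    induction i with
    | zero => exact ⟨h0, h1⟩
    | succ i ih =>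
      obtain ⟨⟨Λ, h⟩, Λ', h'⟩ := ih
      exact ⟨⟨Λ', h'⟩, BondFactor.exists_succ har (hL.mono har (Nat.le_add_right L i)) h h'⟩
  exact this.1

theorem Matrix.exists_eq_smul_one_of_commute [Nonempty n] {M : Matrix n n K}
    (h : ∀ X, M * X = X * M) : ∃ c : K, M = c • 1 := by
  obtain ⟨c, hc⟩ := Matrix.mem_range_scalar_of_commute_single (M := M)
    fun i j _ => (h (Matrix.single i j 1)).symm
  exact ⟨c, by rw [← hc, Matrix.smul_one_eq_diagonal]; rfl⟩

/-- Derivations of a full matrix algebra are inner. -/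
theorem Matrix.exists_eq_commutator_of_derivation [Nonempty n]
    (δ : Matrix n n K →ₗ[K] Matrix n n K) (hδ : ∀ X Y, δ (X * Y) = δ X * Y + X * δ Y) :
    ∃ g, ∀ X, δ X = g * X - X * g := by
  obtain ⟨o⟩ := ‹Nonempty n›
  refine ⟨∑ i, δ (Matrix.single i o 1) * Matrix.single o i 1, fun X => ?_⟩
  have hone : ∑ i : n, Matrix.single i o (1 : K) * Matrix.single o i 1 = 1 := by
    simp only [Matrix.single_mul_single_same, mul_one]
    exact Matrix.sum_single_one
  have hcol : ∀ i, X * Matrix.single i o (1 : K) = ∑ j, X j i • Matrix.single j o 1 := by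
    intro i
    ext a b
    rcases eq_or_ne o b with rfl | hb
    · simp [Matrix.sum_apply, Matrix.single_apply]
    · simp [Matrix.sum_apply, Matrix.mul_apply, hb]
  have hrow : ∀ j, ∑ i, X j i • Matrix.single o i (1 : K) = Matrix.single o j 1 * X := by
    intro j
    ext a b
    rcases eq_or_ne o a with rfl | ha
    · simp [Matrix.sum_apply, Matrix.single_apply]
    · simp [Matrix.sum_apply, Matrix.mul_apply, ha]
  have hX : ∑ i, δ (X * Matrix.single i o 1) * Matrix.single o i 1 =
      (∑ i, δ (Matrix.single i o 1) * Matrix.single o i 1) * X := by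
    simp_rw [hcol, map_sum, map_smul, Finset.sum_mul, smul_mul_assoc]
    rw [Finset.sum_comm]
    refine Finset.sum_congr rfl fun j _ => ?_
    rw [mul_assoc, ← hrow, Finset.mul_sum]
    exact Finset.sum_congr rfl fun i _ => (mul_smul_comm _ _ _).symm
  rw [← hX]
  simp_rw [hδ, add_mul, Finset.sum_add_distrib, mul_assoc, ← Finset.mul_sum, hone]
  simp

/-- If `bondSum` factors at two consecutive separating lengths, then `F` telescopes up to a
multiple of `A a * A b`. -/
theorem exists_telescoping [Fintype P] [Nonempty n] (hal : ∑ q, al q * A q = 1)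
    (har : ∑ q, A q * ar q = 1) {L : ℕ} (hL : TraceSeparating A L)
    (h0 : ∃ Λ, BondFactor A F L Λ) (h1 : ∃ Λ, BondFactor A F (L + 1) Λ) :
    ∃ (B : P → Matrix n n K) (c : K),
      ∀ a b, F a b = A a * B b - B a * A b + c • (A a * A b) := by
  have hspan := hL.mono har (Nat.le_add_right L (L + 1))
  obtain ⟨Λ, hΛ⟩ := h0
  obtain ⟨Λ₁, hΛ₁⟩ := exists_bondFactor har hL ⟨Λ, hΛ⟩ h1 (L + 1)
  obtain ⟨Λ₂, hΛ₂⟩ := exists_bondFactor har hL ⟨Λ, hΛ⟩ h1 (L + 1 + 1)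
  have hl := hΛ₁.mul_left hspan hΛ₂
  have hr := hΛ₁.mul_right hspan hΛ₂
  -- the factor at length `2 * L + 1` splits into two one-sided parts
  let μ : P → Matrix n n K →ₗ[K] Matrix n n K := fun q =>
    ∑ r, Λ q r ∘ₗ LinearMap.mulRight K (al r)
  let ν : P → Matrix n n K → Matrix n n K := fun p Y => ∑ r, al r * Λ r p Y
  have hsplit : ∀ q p Z Y, Λ₁ q p (Z * Y) = μ q Z * Y * A p + A q * Z * ν p Y := by
    intro q p Z Y
    have : Z * Y = ∑ r, Z * al r * A r * Y := by
      simp_rw [← Finset.sum_mul, mul_assoc Z, ← Finset.mul_sum, hal, mul_one]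
    rw [this, map_sum]
    simp_rw [hΛ.mul_mul hL hL hΛ hΛ₁]
    simp [μ, ν, Finset.sum_add_distrib, Finset.sum_mul, Finset.mul_sum, mul_assoc]
  have hmid : ∀ Z, ∃ M, (∀ q, μ q Z - μ q 1 * Z = A q * M) ∧
      ∀ p, ν p Z - Z * ν p 1 = M * A p := by
    refine fun Z => exists_middle hal har fun q p => ?_
    have e1 := hsplit q p Z 1
    have e2 := hsplit q p 1 Z
    rw [mul_one] at e1
    rw [one_mul, e1] at e2
    simp only [mul_one] at e2
    linear_combination (norm := noncomm_ring) e2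
  let γ : Matrix n n K →ₗ[K] Matrix n n K :=
    ∑ q, LinearMap.mulLeft K (al q) ∘ₗ (μ q - LinearMap.mulLeft K (μ q 1))
  have hγ : ∀ Z M, (∀ q, μ q Z - μ q 1 * Z = A q * M) → γ Z = M := by
    intro Z M hM
    simp [γ, hM, ← mul_assoc, ← Finset.sum_mul, hal]
  have hμ : ∀ q Z, μ q Z = μ q 1 * Z + A q * γ Z := by
    intro q Z
    obtain ⟨M, hM, -⟩ := hmid Z
    rw [hγ Z M hM, ← hM]
    abel
  have hν : ∀ p Z, ν p Z = Z * ν p 1 + γ Z * A p := by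
    intro p Z
    obtain ⟨M, hM, hM'⟩ := hmid Z
    rw [hγ Z M hM, ← hM']
    abel
  have hΛ₁' : ∀ q p Z, Λ₁ q p Z = μ q 1 * Z * A p + A q * γ Z * A p + A q * Z * ν p 1 := by
    intro q p Z
    have := hsplit q p Z 1
    rw [mul_one] at this
    rw [this, hμ]
    noncomm_ring
  have hder : ∀ Z Y, γ (Z * Y) = γ Z * Y + Z * γ Y := by
    intro Z Y
    refine eq_of_forall_left_mul hal fun q => eq_of_forall_right_mul har fun p => ?_
    have := hsplit q p Z Y
    rw [hΛ₁', hμ q Z, hν p Y] at this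
    linear_combination (norm := noncomm_ring) this
  obtain ⟨g, hg⟩ := Matrix.exists_eq_commutator_of_derivation γ hder
  obtain ⟨a, ha⟩ : ∃ a : P → Matrix n n K, ∀ q, a q = μ q 1 + A q * g := ⟨_, fun _ => rfl⟩
  obtain ⟨b, hb⟩ : ∃ b : P → Matrix n n K, ∀ q, b q = ν q 1 - g * A q := ⟨_, fun _ => rfl⟩
  have hab : ∀ q p Z, Λ₁ q p Z = a q * Z * A p + A q * Z * b p := by
    intro q p Z
    rw [hΛ₁', hg, ha, hb]
    noncomm_ring
  -- `F` agrees with the factor evaluated at `1`, up to a central multiple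
  have hF : ∃ c : K, ∀ q p, F q p = a q * A p + A q * b p + c • (A q * A p) := by
    have hbal : ∀ q r p, (F q r - (a q * A r + A q * b r)) * A p =
        A q * (F r p - (a r * A p + A r * b p)) := by
      intro q r p
      have e1 := hl q r p 1
      have e2 := hr q r p 1
      simp only [mul_one, one_mul, hab] at e1 e2
      rw [e1] at e2
      linear_combination (norm := noncomm_ring) e2
    have hmid' : ∀ r, ∃ M, (∀ q, F q r - (a q * A r + A q * b r) = A q * M) ∧
        ∀ p, F r p - (a r * A p + A r * b p) = M * A p :=
      fun r => exists_middle hal har fun q p => hbal q r p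
    choose M hM hM' using hmid'
    obtain ⟨h, hMl, hMr⟩ := exists_middle hal har (U := M) (V := M)
      fun r s => by rw [← hM, ← hM']
    have hcomm : ∀ w : List P, h * wordProd A w = wordProd A w * h := by
      intro w
      induction w with
      | nil => simp
      | cons x w ih => rw [wordProd_cons, ← mul_assoc, ← hMr, hMl, mul_assoc, ih, mul_assoc]
    obtain ⟨c, hc⟩ := Matrix.exists_eq_smul_one_of_commute (M := h) fun X => by
      have := linearMap_ext_wordProd hL (f := LinearMap.mulLeft K h)
        (g := LinearMap.mulRight K h) fun w _ => hcomm w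
      exact LinearMap.congr_fun this X
    refine ⟨c, fun q p => ?_⟩
    rw [← sub_eq_iff_eq_add', hM', hMr, hc]
    simp
  obtain ⟨c, hF⟩ := hF
  have hk : ∀ r s Z, (a r + b r) * Z * A s = A r * (Z * (a s + b s)) := by
    intro r s Z
    refine eq_of_forall_left_mul hal fun q => eq_of_forall_right_mul har fun p => ?_
    have e1 := hl q r p (Z * A s)
    have e2 := hr q s p (A r * Z)
    rw [← mul_assoc (A r), e2] at e1
    simp only [hab, hF, add_mul, mul_add, smul_mul_assoc, mul_smul_comm, mul_assoc] at e1
    linear_combination (norm := noncomm_ring) -e1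
  obtain ⟨V, hV, hV'⟩ := exists_middle hal har (U := fun r => a r + b r)
    (V := fun r => a r + b r) fun r s => by simpa using hk r s 1
  obtain ⟨v, hv⟩ := Matrix.exists_eq_smul_one_of_commute (M := V) fun X => by
    refine eq_of_forall_left_mul hal fun r => eq_of_forall_right_mul har fun s => ?_
    have := hk r s X
    rw [hV, hV'] at this
    simpa only [mul_assoc] using this
  refine ⟨b, v + c, fun q p => ?_⟩
  have := hV q
  rw [hv, ← eq_sub_iff_add_eq] at this
  rw [hF, this, add_smul, sub_mul]
  simp
  abel

end Injective

section Chain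

theorem cyc_zero {N : ℕ} (n : Fin N) : cyc n 0 = n :=
  Fin.ext (by simp [cyc, Nat.mod_eq_of_lt n.isLt])

theorem cyc_injOn {N : ℕ} (n : Fin N) {s t : ℕ} (hs : s < N) (ht : t < N)
    (h : cyc n s = cyc n t) : s = t :=
  (Nat.ModEq.add_left_cancel' n.val (Fin.ext_iff.1 h)).eq_of_lt_of_lt hs ht

theorem rotate_ofFn {α : Type*} {N : ℕ} (h : Fin (N + 2) → α) (n : Fin (N + 2)) :
    (List.ofFn h).rotate n =
      h n :: h (cyc n 1) :: List.ofFn fun i : Fin N => h (cyc n (i.val + 2)) := by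
  refine List.ext_getElem (by simp) fun i h1 h2 => ?_
  rw [List.getElem_rotate, List.getElem_ofFn]
  rcases i with _ | _ | i
  · simp [Nat.mod_eq_of_lt n.isLt]
  · simp [cyc, Nat.add_comm 1 n.val]
  · simp [cyc, Nat.add_comm _ n.val]

variable {d D : ℕ} (T : Fin d → Fin d → Matrix (Fin D) (Fin D) ℂ)
  (G : Matrix (Fin 2 → Fin d) (Fin 2 → Fin d) ℂ)

/-- The two-site operator `G` applied to the ket indices of two adjacent tensors. -/
noncomputable def bondTensor (p q : Fin d × Fin d) : Matrix (Fin D) (Fin D) ℂ :=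
  ∑ k1 : Fin d, ∑ k2 : Fin d, G ![p.1, q.1] ![k1, k2] • (T k1 p.2 * T k2 q.2)

theorem localOp_mul_mpo_apply {N : ℕ} (n : Fin (N + 2)) (x y : Fin (N + 2) → Fin d) :
    (localOp G n * mpo T : Matrix (Fin (N + 2) → Fin d) (Fin (N + 2) → Fin d) ℂ) x y =
      headTerm (fun p : Fin d × Fin d => T p.1 p.2) (bondTensor T G)
        ((List.ofFn fun m => (x m, y m)).rotate n) := by
  have hne : cyc n 1 ≠ n := fun h =>
    absurd (cyc_injOn n (by omega) (by omega) (h.trans (cyc_zero n).symm)) (by omega)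
  have hne0 : ∀ i : Fin N, cyc n (i.val + 2) ≠ n := fun i h =>
    absurd (cyc_injOn n (by omega) (by omega) (h.trans (cyc_zero n).symm)) (by omega)
  have hne1 : ∀ i : Fin N, cyc n (i.val + 2) ≠ cyc n 1 := fun i h =>
    absurd (cyc_injOn n (by omega) (by omega) h) (by omega)
  let e : Fin d × Fin d → Fin (N + 2) → Fin d := fun k =>
    Function.update (Function.update x n k.1) (cyc n 1) k.2
  have he0 : ∀ k, e k n = k.1 := fun k => by simp [e, Function.update_of_ne hne.symm]
  have he1 : ∀ k, e k (cyc n 1) = k.2 := fun k => by simp [e]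
  have he2 : ∀ k m, m ≠ n → m ≠ cyc n 1 → e k m = x m := fun k m h h' => by
    simp [e, Function.update_of_ne h, Function.update_of_ne h']
  have hpair : ∀ z : Fin (N + 2) → Fin d,
      (fun t : Fin 2 => z (cyc n t.val)) = ![z n, z (cyc n 1)] := fun z => by
    ext t
    fin_cases t <;> simp [cyc_zero]
  have hmpo : ∀ z, mpo T z y = (T (z n) (y n) * (T (z (cyc n 1)) (y (cyc n 1)) *
      wordProd (fun p : Fin d × Fin d => T p.1 p.2)
        (List.ofFn fun i : Fin N => (z (cyc n (i.val + 2)), y (cyc n (i.val + 2)))))).trace := by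
    intro z
    have h := trace_wordProd_rotate (A := fun p : Fin d × Fin d => T p.1 p.2)
      (List.ofFn fun m => (z m, y m)) n
    rw [rotate_ofFn, wordProd_cons, wordProd_cons] at h
    rw [h]
    simp [mpo, wordProd, List.map_ofFn, Function.comp_def]
  rw [Matrix.mul_apply, rotate_ofFn]
  simp only [headTerm, bondTensor, Finset.sum_mul, Matrix.trace_sum, smul_mul_assoc,
    Matrix.trace_smul, smul_eq_mul, mul_assoc]
  rw [← Fintype.sum_prod_type']
  symm
  refine Fintype.sum_of_injective e (fun k k' h => ?_) _ _ (fun z hz => ?_) fun k => ?_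
  · exact Prod.ext (by rw [← he0 k, h, he0]) (by rw [← he1 k, h, he1])
  · rw [localOp, Matrix.of_apply, if_neg, mul_zero, zero_mul]
    intro hxz
    refine hz ⟨(z n, z (cyc n 1)), funext fun m => ?_⟩
    rcases eq_or_ne m n with rfl | h0
    · exact he0 _
    rcases eq_or_ne m (cyc n 1) with rfl | h1
    · exact he1 _
    rw [he2 _ m h0 h1]
    refine hxz m fun t => ?_
    fin_cases t
    · simpa [cyc_zero] using h0
    · exact h1
  · rw [hmpo, localOp, Matrix.of_apply, if_pos, hpair, hpair, he0, he1, mul_one]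
    · simp only [he2 k _ (hne0 _) (hne1 _)]
    · intro m hm
      exact (he2 k m (by simpa [cyc_zero] using hm 0) (hm 1)).symm

theorem opSum_mul_mpo_apply {N : ℕ} (hN : 2 ≤ N) (x y : Fin N → Fin d) :
    (opSum G * mpo T : Matrix (Fin N → Fin d) (Fin N → Fin d) ℂ) x y =
      ringSum (fun p : Fin d × Fin d => T p.1 p.2) (bondTensor T G)
        (List.ofFn fun m => (x m, y m)) := by
  obtain ⟨N, rfl⟩ := Nat.exists_eq_add_of_le' hN
  rw [opSum, Finset.sum_mul, Matrix.sum_apply, ringSum, List.length_ofFn, Finset.sum_range]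
  exact Finset.sum_congr rfl fun n _ => localOp_mul_mpo_apply T G n x y

theorem opSum_mul_mpo_eq_zero_iff {N : ℕ} (hN : 2 ≤ N) :
    opSum (N := N) G * mpo T = 0 ↔ ∀ l : List (Fin d × Fin d), l.length = N →
      ringSum (fun p : Fin d × Fin d => T p.1 p.2) (bondTensor T G) l = 0 := by
  constructor
  · rintro h l rfl
    have := opSum_mul_mpo_apply T G hN (fun m => (l.get m).1) (fun m => (l.get m).2)
    rw [h] at this
    simpa using this.symm
  · intro h
    ext x y
    rw [opSum_mul_mpo_apply T G hN]
    exact h _ (by simp)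

theorem InjectiveLen'.traceSeparating {P : Type*} {A : P → Matrix (Fin D) (Fin D) ℂ} {L : ℕ}
    (h : InjectiveLen' A L) : TraceSeparating A L := by
  rintro X hX
  refine h (funext fun i => ?_)
  have := hX (List.ofFn i) (by simp)
  simpa [wordProd, List.map_ofFn, Function.comp_def] using this

theorem TransferFixedPoints'.exists_inverses {P : Type*} [Fintype P]
    {A : P → Matrix (Fin D) (Fin D) ℂ} {ρL ρR : Matrix (Fin D) (Fin D) ℂ}
    (h : TransferFixedPoints' A ρL ρR) :
    ∃ al ar : P → Matrix (Fin D) (Fin D) ℂ, ∑ q, al q * A q = 1 ∧ ∑ q, A q * ar q = 1 := by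
  obtain ⟨hL, hR, eL, eR⟩ := h
  refine ⟨fun q => ρL⁻¹ * ((A q)ᴴ * ρL), fun q => ρR * (A q)ᴴ * ρR⁻¹, ?_, ?_⟩
  · simp_rw [mul_assoc ρL⁻¹, ← Finset.mul_sum, eL]
    exact Matrix.nonsing_inv_mul _ ((Matrix.isUnit_iff_isUnit_det _).1 hL.isUnit)
  · simp_rw [← mul_assoc, ← Finset.sum_mul, eR]
    exact Matrix.mul_nonsing_inv _ ((Matrix.isUnit_iff_isUnit_det _).1 hR.isUnit)

end Chain

/-- Let the vectorized tensor `T̂^{(i,j)} = T^{ij}` of the MPDO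
`ρ_N` be injective with injectivity length `L` and admit positive definite
transfer fixed points, and let `N > 2L + 3`. Then the strong symmetry condition
`Σ_n G_n ρ_N = 0` holds iff there is a family `B` with
`Σ_k G^{i_1 i_2}_{k_1 k_2} T^{k_1 j_1} T^{k_2 j_2}
 = T^{i_1 j_1} B^{i_2 j_2} − B^{i_1 j_1} T^{i_2 j_2}`. -/
theorem strong_symmetry_iff_local
    (d D : ℕ) (hd : 1 ≤ d) (hD : 1 ≤ D)
    (T : Fin d → Fin d → Matrix (Fin D) (Fin D) ℂ)
    (L : ℕ) (hinj : InjectiveLen' (fun p : Fin d × Fin d => T p.1 p.2) L)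
    (ρL ρR : Matrix (Fin D) (Fin D) ℂ)
    (hfix : TransferFixedPoints' (fun p : Fin d × Fin d => T p.1 p.2) ρL ρR)
    (G : Matrix (Fin 2 → Fin d) (Fin 2 → Fin d) ℂ)
    (N : ℕ) (hN : 2 * L + 3 < N) :
    opSum (N := N) G * mpo T = 0
      ↔ ∃ B : Fin d → Fin d → Matrix (Fin D) (Fin D) ℂ,
          ∀ i1 i2 j1 j2 : Fin d,
            (∑ k1 : Fin d, ∑ k2 : Fin d,
                G ![i1, i2] ![k1, k2] • (T k1 j1 * T k2 j2))
            = T i1 j1 * B i2 j2 - B i1 j1 * T i2 j2 := by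
  obtain ⟨al, ar, hal, har⟩ := hfix.exists_inverses
  have hL := hinj.traceSeparating
  have : Nonempty (Fin D) := ⟨⟨0, hD⟩⟩
  rw [opSum_mul_mpo_eq_zero_iff T G (by omega)]
  constructor
  · intro h
    obtain ⟨B, c, hB⟩ := exists_telescoping hal har hL
      (exists_bondFactor_of_ringSum hL (hL.mono har (m := N - L - 2) (by omega))
        fun l hl => h l (by omega))
      (exists_bondFactor_of_ringSum (hL.mono har (Nat.le_succ L))
        (hL.mono har (m := N - L - 3) (by omega)) fun l hl => h l (by omega))
    have hc : c = 0 := by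
      by_contra hc
      refine one_ne_zero (hL.mono har (m := N) (by omega) 1 fun w hw => ?_)
      have := ringSum_of_telescoping B c hB w (by omega)
      rw [h w hw, eq_comm, mul_eq_zero, mul_eq_zero] at this
      rw [one_mul]
      exact (this.resolve_left (Nat.cast_ne_zero.2 (by omega))).resolve_left hc
    refine ⟨fun i j => B (i, j), fun i1 i2 j1 j2 => ?_⟩
    simpa [hc, bondTensor] using hB (i1, j1) (i2, j2)
  · rintro ⟨B, hB⟩ l hl
    rw [ringSum_of_telescoping (fun p => B p.1 p.2) 0
      (fun p q => by simpa [bondTensor] using hB p.1 q.1 p.2 q.2) l (by omega)]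
    simp
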